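/- arXiv:2007.06264 — 3 statements merged into one kernel-verified Lean document; each statement's English description precedes it below -/
import Mathlib

section
/- Fix q ∈ (0,1), c ∈ ℂ∖ℝ with d := conj(c), a real number ζ ≠ 0, and radii R₁ > 0, R₂ > 0. Then there exists a constant A > 0, depending only on q, c, d, R₁, R₂ and ζ (but not on a, b or n), such that for all complex numbers a, b with |a| ≤ R₁ and |b| ≤ R₂ and all integers n ≥ 1, one has |(aζq^{−n};q)_∞ (bζq^{−n};q)_∞ / ((cζq^{−n};q)_∞ (dζq^{−n};q)_∞)| ≤ A · (R₁R₂/(cd))^n, where cd = |c|² > 0. -/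
/-- The infinite q-Pochhammer symbol `(u; q)_∞ = ∏_{n=0}^∞ (1 - u qⁿ)`. -/
noncomputable def qPochC (q : ℝ) (u : ℂ) : ℂ := ∏' n : ℕ, (1 - u * (q : ℂ) ^ n)

lemma summable_norm_neg_mul_pow {q : ℝ} (hq0 : 0 < q) (hq1 : q < 1) (u : ℂ) :
    Summable fun n : ℕ => ‖-(u * (q : ℂ) ^ n)‖ := by
  simp only [norm_neg, norm_mul, norm_pow, Complex.norm_real, Real.norm_of_nonneg hq0.le]
  exact (summable_geometric_of_lt_one hq0.le hq1).mul_left _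

lemma multipliable_qPochC {q : ℝ} (hq0 : 0 < q) (hq1 : q < 1) (u : ℂ) :
    Multipliable fun n : ℕ => 1 - u * (q : ℂ) ^ n := by
  simpa only [sub_eq_add_neg] using
    multipliable_one_add_of_summable (summable_norm_neg_mul_pow hq0 hq1 u)

lemma tendsto_norm_prod_qPochC {q : ℝ} (hq0 : 0 < q) (hq1 : q < 1) (u : ℂ) :
    Filter.Tendsto (fun n : ℕ => ∏ k ∈ Finset.range n, ‖1 - u * (q : ℂ) ^ k‖) Filter.atTop
      (nhds ‖qPochC q u‖) := by
  simpa only [qPochC, norm_prod] using (multipliable_qPochC hq0 hq1 u).hasProd.tendsto_prod_nat.norm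

lemma qPochC_ne_zero {q : ℝ} (hq0 : 0 < q) (hq1 : q < 1) {u : ℂ}
    (hu : ∀ n : ℕ, 1 - u * (q : ℂ) ^ n ≠ 0) : qPochC q u ≠ 0 := by
  have h := tprod_one_add_ne_zero_of_summable (f := fun n : ℕ => -(u * (q : ℂ) ^ n))
    (by simpa only [← sub_eq_add_neg] using hu) (summable_norm_neg_mul_pow hq0 hq1 u)
  simpa only [qPochC, sub_eq_add_neg] using h

lemma qPochC_eq_mul {q : ℝ} (hq0 : 0 < q) (hq1 : q < 1) (u : ℂ) :
    qPochC q u = (1 - u) * qPochC q (u * q) := by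
  have h := tprod_eq_zero_mul' (f := fun n : ℕ => 1 - u * (q : ℂ) ^ n)
    (by simpa only [pow_succ', mul_assoc] using multipliable_qPochC hq0 hq1 (u * q))
  simpa only [qPochC, pow_succ', mul_assoc, pow_zero, mul_one] using h

lemma norm_qPochC_le {q : ℝ} (hq0 : 0 < q) (hq1 : q < 1) {u : ℂ} {r : ℝ} (hu : ‖u‖ ≤ r) :
    ‖qPochC q u‖ ≤ ‖qPochC q (-r : ℝ)‖ := by
  refine le_of_tendsto_of_tendsto' (tendsto_norm_prod_qPochC hq0 hq1 u)
    (tendsto_norm_prod_qPochC hq0 hq1 _) fun n => ?_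
  refine Finset.prod_le_prod (fun _ _ => norm_nonneg _) fun k _ => ?_
  have hr : 0 ≤ r := (norm_nonneg u).trans hu
  have h1 : (1 : ℂ) - ((-r : ℝ) : ℂ) * (q : ℂ) ^ k = ((1 + r * q ^ k : ℝ) : ℂ) := by
    push_cast; ring
  rw [h1, Complex.norm_real, Real.norm_of_nonneg (by positivity)]
  refine (norm_sub_le _ _).trans ?_
  rw [norm_one, norm_mul, norm_pow, Complex.norm_real, Real.norm_of_nonneg hq0.le]
  gcongr

lemma norm_qPochC_mul_zpow_neg {q : ℝ} (hq0 : 0 < q) (hq1 : q < 1) {w : ℂ} (hw : w ≠ 0) (n : ℕ) :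
    ‖qPochC q (w * (q : ℂ) ^ (-(n : ℤ)))‖ =
      (‖qPochC q w‖ * ∏ k ∈ Finset.range n, ‖1 - q / w * (q : ℂ) ^ k‖) *
        (‖w‖ ^ n * ∏ k ∈ Finset.range n, (q ^ (k + 1))⁻¹) := by
  have hq : (q : ℂ) ≠ 0 := by exact_mod_cast hq0.ne'
  induction n with
  | zero => simp
  | succ n ih =>
    have h1 : w * (q : ℂ) ^ (-((n + 1 : ℕ) : ℤ)) * q = w * (q : ℂ) ^ (-(n : ℤ)) := by
      rw [zpow_neg, zpow_neg, zpow_natCast, zpow_natCast]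
      field_simp
      ring
    have h2 : 1 - w * (q : ℂ) ^ (-((n + 1 : ℕ) : ℤ)) =
        -w * ((q : ℂ) ^ (n + 1))⁻¹ * (1 - q / w * (q : ℂ) ^ n) := by
      rw [zpow_neg, zpow_natCast]
      field_simp
      ring
    rw [qPochC_eq_mul hq0 hq1, h1, h2, norm_mul, ih, Finset.prod_range_succ,
      Finset.prod_range_succ, norm_mul, norm_mul, norm_neg, norm_inv, norm_pow,
      Complex.norm_real, Real.norm_of_nonneg hq0.le]
    ring

lemma exists_bounds_of_tendsto_pos {x : ℕ → ℝ} {l : ℝ} (hx : ∀ n, 0 < x n) (hl : 0 < l)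
    (h : Filter.Tendsto x Filter.atTop (nhds l)) :
    ∃ m M : ℝ, 0 < m ∧ 0 < M ∧ ∀ n, m ≤ x n ∧ x n ≤ M := by
  obtain ⟨M, hM⟩ := h.bddAbove_range
  obtain ⟨B, hB⟩ := (h.inv₀ hl.ne').bddAbove_range
  have hM' : ∀ n, x n ≤ M := fun n => hM ⟨n, rfl⟩
  have hB' : ∀ n, (x n)⁻¹ ≤ B := fun n => hB ⟨n, rfl⟩
  have hB0 : 0 < B := (inv_pos.2 (hx 0)).trans_le (hB' 0)
  exact ⟨B⁻¹, M, inv_pos.2 hB0, (hx 0).trans_le (hM' 0),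
    fun n => ⟨inv_le_of_inv_le₀ (hx n) (hB' n), hM' n⟩⟩

lemma exists_bounds_norm_qPochC_mul_zpow_neg {q : ℝ} (hq0 : 0 < q) (hq1 : q < 1) {w : ℂ}
    (hw : w ≠ 0) (hw' : ∀ r : ℝ, 0 < r → w ≠ r) :
    ∃ m M : ℝ, 0 < m ∧ 0 < M ∧ ∀ n : ℕ,
      m * (‖w‖ ^ n * ∏ k ∈ Finset.range n, (q ^ (k + 1))⁻¹) ≤
        ‖qPochC q (w * (q : ℂ) ^ (-(n : ℤ)))‖ ∧
      ‖qPochC q (w * (q : ℂ) ^ (-(n : ℤ)))‖ ≤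
        M * (‖w‖ ^ n * ∏ k ∈ Finset.range n, (q ^ (k + 1))⁻¹) := by
  have hq : (q : ℂ) ≠ 0 := by exact_mod_cast hq0.ne'
  have h1 : ∀ n : ℕ, 1 - w * (q : ℂ) ^ n ≠ 0 := fun n h => by
    refine hw' (q ^ n)⁻¹ (by positivity) ?_
    push_cast
    exact eq_inv_of_mul_eq_one_left (sub_eq_zero.1 h).symm
  have h2 : ∀ n : ℕ, 1 - q / w * (q : ℂ) ^ n ≠ 0 := fun n h => by
    refine hw' (q ^ (n + 1)) (by positivity) ?_
    field_simp at h
    push_cast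
    linear_combination h
  have hP := norm_pos_iff.2 (qPochC_ne_zero hq0 hq1 h1)
  obtain ⟨m, M, hm, hM, h⟩ := exists_bounds_of_tendsto_pos
    (fun n => mul_pos hP (Finset.prod_pos fun k _ => norm_pos_iff.2 (h2 k)))
    (mul_pos hP (norm_pos_iff.2 (qPochC_ne_zero hq0 hq1 h2)))
    ((tendsto_norm_prod_qPochC hq0 hq1 (q / w)).const_mul ‖qPochC q w‖)
  refine ⟨m, M, hm, hM, fun n => ?_⟩
  rw [norm_qPochC_mul_zpow_neg hq0 hq1 hw]
  have hT : 0 ≤ ‖w‖ ^ n * ∏ k ∈ Finset.range n, (q ^ (k + 1))⁻¹ := by positivity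
  exact ⟨mul_le_mul_of_nonneg_right (h n).1 hT, mul_le_mul_of_nonneg_right (h n).2 hT⟩

lemma exists_forall_norm_qPochC_mul_zpow_neg_le {q : ℝ} (hq0 : 0 < q) (hq1 : q < 1) {ζ : ℝ}
    (hζ : ζ ≠ 0) {R : ℝ} (hR : 0 < R) :
    ∃ M : ℝ, 0 < M ∧ ∀ a : ℂ, ‖a‖ ≤ R → ∀ n : ℕ,
      ‖qPochC q (a * ζ * (q : ℂ) ^ (-(n : ℤ)))‖ ≤
        M * ((R * |ζ|) ^ n * ∏ k ∈ Finset.range n, (q ^ (k + 1))⁻¹) := by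
  have hr : 0 < R * |ζ| := mul_pos hR (abs_pos.2 hζ)
  obtain ⟨_, M, _, hM, h⟩ := exists_bounds_norm_qPochC_mul_zpow_neg hq0 hq1
    (w := (-(R * |ζ|) : ℝ)) (by exact_mod_cast (neg_lt_zero.2 hr).ne)
    (fun r h0 h => by
      have : -(R * |ζ|) = r := by exact_mod_cast h
      linarith)
  refine ⟨M, hM, fun a ha n => ?_⟩
  have h3 := (h n).2
  rw [Complex.norm_real, norm_neg, Real.norm_of_nonneg hr.le] at h3
  refine le_trans ?_ h3
  have h4 : ((-(R * |ζ|) : ℝ) : ℂ) * (q : ℂ) ^ (-(n : ℤ)) =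
      ((-(R * |ζ| * q ^ (-(n : ℤ))) : ℝ) : ℂ) := by push_cast; ring
  rw [h4]
  refine norm_qPochC_le hq0 hq1 ?_
  rw [norm_mul, norm_mul, norm_zpow, Complex.norm_real, Complex.norm_real, Real.norm_eq_abs,
    Real.norm_of_nonneg hq0.le]
  gcongr

/-- Uniform estimate on the ratio of q-Pochhammer symbols at the points `ζ q^{-n}`:
there is a constant `A > 0` (independent of `a`, `b`, `n`) such that for `|a| ≤ R₁`,
`|b| ≤ R₂` and `n ≥ 1`,
`|(aζq^{-n};q)_∞ (bζq^{-n};q)_∞ / ((cζq^{-n};q)_∞ (dζq^{-n};q)_∞)| ≤ A (R₁R₂/(cd))ⁿ`,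
where `d = conj c` so that `cd = |c|²`. -/
theorem stmt1 (q : ℝ) (hq0 : 0 < q) (hq1 : q < 1)
    (c : ℂ) (hc : c.im ≠ 0) (d : ℂ) (hd : d = (starRingEnd ℂ) c)
    (ζ : ℝ) (hζ : ζ ≠ 0) (R₁ R₂ : ℝ) (hR₁ : 0 < R₁) (hR₂ : 0 < R₂) :
    ∃ A : ℝ, 0 < A ∧ ∀ (a b : ℂ), ‖a‖ ≤ R₁ → ‖b‖ ≤ R₂ → ∀ n : ℕ, 1 ≤ n →
      ‖(qPochC q (a * ζ * (q : ℂ) ^ (-(n : ℤ))) * qPochC q (b * ζ * (q : ℂ) ^ (-(n : ℤ)))) /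
        (qPochC q (c * ζ * (q : ℂ) ^ (-(n : ℤ))) * qPochC q (d * ζ * (q : ℂ) ^ (-(n : ℤ))))‖ ≤
        A * (R₁ * R₂ / ‖c‖ ^ 2) ^ n := by
  have hc0 : c ≠ 0 := fun h => hc (by simp [h])
  have hζ' : (ζ : ℂ) ≠ 0 := by exact_mod_cast hζ
  have hcd : ‖d‖ = ‖c‖ := by rw [hd, Complex.norm_conj]
  have hd0 : d ≠ 0 := norm_pos_iff.1 (hcd ▸ norm_pos_iff.2 hc0)
  have hdim : d.im ≠ 0 := by simpa [hd] using hc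
  have hnonreal : ∀ z : ℂ, z.im ≠ 0 → ∀ r : ℝ, 0 < r → z * ζ ≠ r := fun z hz r _ h => by
    have := congrArg Complex.im h
    simp [hz, hζ] at this
  obtain ⟨M₁, hM₁, h₁⟩ := exists_forall_norm_qPochC_mul_zpow_neg_le hq0 hq1 hζ hR₁
  obtain ⟨M₂, hM₂, h₂⟩ := exists_forall_norm_qPochC_mul_zpow_neg_le hq0 hq1 hζ hR₂
  obtain ⟨m₁, _, hm₁, _, h₃⟩ := exists_bounds_norm_qPochC_mul_zpow_neg hq0 hq1
    (mul_ne_zero hc0 hζ') (hnonreal c hc)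
  obtain ⟨m₂, _, hm₂, _, h₄⟩ := exists_bounds_norm_qPochC_mul_zpow_neg hq0 hq1
    (mul_ne_zero hd0 hζ') (hnonreal d hdim)
  refine ⟨M₁ * M₂ / (m₁ * m₂), by positivity, fun a b ha hb n _ => ?_⟩
  have h₃' := (h₃ n).1
  have h₄' := (h₄ n).1
  rw [norm_mul, Complex.norm_real, Real.norm_eq_abs] at h₃' h₄'
  rw [hcd] at h₄'
  have hcpos : 0 < ‖c‖ := norm_pos_iff.2 hc0
  have hζpos : 0 < |ζ| := abs_pos.2 hζ
  have hT : 0 < ∏ k ∈ Finset.range n, (q ^ (k + 1))⁻¹ :=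
    Finset.prod_pos fun _ _ => by positivity
  rw [norm_div, norm_mul, norm_mul]
  refine (div_le_div₀ (by positivity) (mul_le_mul (h₁ a ha n) (h₂ b hb n) (norm_nonneg _)
    (by positivity)) (by positivity) (mul_le_mul h₃' h₄' (by positivity)
    (norm_nonneg _))).trans_eq ?_
  generalize ∏ k ∈ Finset.range n, (q ^ (k + 1))⁻¹ = T at hT
  simp only [div_pow, mul_pow]
  field_simp
  ring
end

section
/- Let q, t ∈ (0,1) and τ := log_q t. For every real u < 0, the values θ_q(tu) and θ_q(t u^{−1}) are strictly positive real numbers, so ψ_τ(u) is a well-defined strictly positive real number; moreover ψ_τ is quasi-constant: ψ_τ(qu) = ψ_τ(u) for every u < 0. -/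
/-- The infinite q-Pochhammer symbol `(u; q)_∞ = ∏_{n=0}^∞ (1 - u qⁿ)` (real version). -/
noncomputable def qPochR (q u : ℝ) : ℝ := ∏' n : ℕ, (1 - u * q ^ n)

/-- The theta function `θ_q(v) = (v;q)_∞ (q v⁻¹;q)_∞`. -/
noncomputable def thetaQ (q v : ℝ) : ℝ := qPochR q v * qPochR q (q * v⁻¹)

/-- `ψ_τ(u) = (-u)^{2τ-1} θ_q(tu)/θ_q(t u⁻¹)` with `τ = log_q t`, for `u < 0`. -/
noncomputable def psiQ (q t u : ℝ) : ℝ :=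
  (-u) ^ (2 * Real.logb q t - 1) * thetaQ q (t * u) / thetaQ q (t * u⁻¹)

theorem summable_neg_mul_geometric {q : ℝ} (hq0 : 0 < q) (hq1 : q < 1) (u : ℝ) :
    Summable fun n : ℕ => -(u * q ^ n) :=
  ((summable_geometric_of_lt_one hq0.le hq1).mul_left u).neg

theorem multipliable_qPochR {q : ℝ} (hq0 : 0 < q) (hq1 : q < 1) (u : ℝ) :
    Multipliable fun n : ℕ => 1 - u * q ^ n := by
  simpa only [sub_eq_add_neg] using
    Real.multipliable_one_add_of_summable (summable_neg_mul_geometric hq0 hq1 u)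

theorem qPochR_pos {q : ℝ} (hq0 : 0 < q) (hq1 : q < 1) {u : ℝ} (hu : u < 0) :
    0 < qPochR q u := by
  have hpos : ∀ n : ℕ, 0 < 1 - u * q ^ n := fun n => by
    have := mul_neg_of_neg_of_pos hu (pow_pos hq0 n)
    linarith
  have hlog : Summable fun n : ℕ => Real.log (1 - u * q ^ n) := by
    simpa only [sub_eq_add_neg] using
      Real.summable_log_one_add_of_summable (summable_neg_mul_geometric hq0 hq1 u)
  rw [qPochR, ← Real.rexp_tsum_eq_tprod hpos hlog]
  exact Real.exp_pos _

theorem qPochR_eq_mul {q : ℝ} (hq0 : 0 < q) (hq1 : q < 1) (u : ℝ) :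
    qPochR q u = (1 - u) * qPochR q (q * u) := by
  have hshift : (fun n : ℕ => 1 - u * q ^ (n + 1)) = fun n : ℕ => 1 - q * u * q ^ n := by
    funext n
    ring
  have hmul : Multipliable fun n : ℕ => 1 - u * q ^ (n + 1) := by
    rw [hshift]
    exact multipliable_qPochR hq0 hq1 (q * u)
  have hsplit := tprod_eq_zero_mul' (f := fun n : ℕ => 1 - u * q ^ n) hmul
  rw [hshift, pow_zero, mul_one] at hsplit
  exact hsplit

theorem thetaQ_pos {q : ℝ} (hq0 : 0 < q) (hq1 : q < 1) {v : ℝ} (hv : v < 0) :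
    0 < thetaQ q v :=
  mul_pos (qPochR_pos hq0 hq1 hv)
    (qPochR_pos hq0 hq1 (mul_neg_of_pos_of_neg hq0 (inv_lt_zero.mpr hv)))

theorem thetaQ_eq_neg_mul {q : ℝ} (hq0 : 0 < q) (hq1 : q < 1) {v : ℝ} (hv : v < 0) :
    thetaQ q v = -v * thetaQ q (q * v) := by
  have hinv : q * (q * v)⁻¹ = v⁻¹ := by
    field_simp
  rw [thetaQ, thetaQ, hinv, qPochR_eq_mul hq0 hq1 v, qPochR_eq_mul hq0 hq1 v⁻¹]
  have hv0 : v ≠ 0 := hv.ne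
  field_simp
  ring

/-- For `q, t ∈ (0,1)` and `u < 0`, the values `θ_q(tu)` and `θ_q(tu⁻¹)` are strictly
positive, hence `ψ_τ(u)` is a well-defined strictly positive real; moreover `ψ_τ` is
quasi-constant: `ψ_τ(qu) = ψ_τ(u)`. -/
theorem stmt5 (q t : ℝ) (hq0 : 0 < q) (hq1 : q < 1) (ht0 : 0 < t) (ht1 : t < 1)
    (u : ℝ) (hu : u < 0) :
    0 < thetaQ q (t * u) ∧ 0 < thetaQ q (t * u⁻¹) ∧ 0 < psiQ q t u ∧
      psiQ q t (q * u) = psiQ q t u := by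
  have hu' : u⁻¹ < 0 := inv_lt_zero.mpr hu
  have hqu : q * u < 0 := mul_neg_of_pos_of_neg hq0 hu
  have htu : t * u < 0 := mul_neg_of_pos_of_neg ht0 hu
  have htqu : t * (q * u)⁻¹ < 0 := mul_neg_of_pos_of_neg ht0 (inv_lt_zero.mpr hqu)
  have hnum : 0 < thetaQ q (t * u) := thetaQ_pos hq0 hq1 htu
  have hden : 0 < thetaQ q (t * u⁻¹) :=
    thetaQ_pos hq0 hq1 (mul_neg_of_pos_of_neg ht0 hu')
  refine ⟨hnum, hden,
    div_pos (mul_pos (Real.rpow_pos_of_pos (neg_pos.mpr hu) _) hnum) hden, ?_⟩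
  have hrpow : q ^ (2 * Real.logb q t - 1) = t ^ 2 / q := by
    rw [Real.rpow_sub hq0, Real.rpow_one, mul_comm, Real.rpow_mul hq0.le,
      Real.rpow_logb hq0 hq1.ne ht0, Real.rpow_two]
  have hpow : (-(q * u)) ^ (2 * Real.logb q t - 1) =
      t ^ 2 / q * (-u) ^ (2 * Real.logb q t - 1) := by
    rw [← mul_neg, Real.mul_rpow hq0.le (neg_pos.mpr hu).le, hrpow]
  have hθnum : thetaQ q (t * u) = -(t * u) * thetaQ q (t * (q * u)) := by
    rw [thetaQ_eq_neg_mul hq0 hq1 htu, mul_left_comm q t u]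
  have hθden : thetaQ q (t * (q * u)⁻¹) = -(t * (q * u)⁻¹) * thetaQ q (t * u⁻¹) := by
    have harg : q * (t * (q * u)⁻¹) = t * u⁻¹ := by
      field_simp
    rw [thetaQ_eq_neg_mul hq0 hq1 htqu, harg]
  rw [psiQ, psiQ, hpow, hθden, hθnum]
  have hu0 : u ≠ 0 := hu.ne
  have hden0 := hden.ne'
  generalize (-u) ^ (2 * Real.logb q t - 1) = a
  generalize thetaQ q (t * u⁻¹) = b at hden0 ⊢
  field_simp
end

section
/- Let q, t ∈ (0,1), τ := log_q t, ζ₊ > 0, ζ₋ < 0, N ∈ ℤ_{≥1}. Let c = conj(d) ∈ ℂ∖ℝ and set R := |c|. Then for any complex numbers a, b with |ab| < R² · q^{2τ(N−1)+1}, the family (|M̃_N(X; q,t; a,b,c,d)|)_{X∈Ω_N} is summable. -/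
/-- The weight function `W(x; q; a,b,c,d) = (1-q)|x| (ax;q)_∞(bx;q)_∞ / ((cx;q)_∞(dx;q)_∞)`. -/
noncomputable def Wc (q : ℝ) (a b c d : ℂ) (x : ℝ) : ℂ :=
  (((1 - q) * |x| : ℝ) : ℂ) * (qPochC q (a * x) * qPochC q (b * x)) /
    (qPochC q (c * x) * qPochC q (d * x))

/-- A (finite or countably infinite) particle configuration: a countable set of nonzero
reals, whose points can be enumerated from the outside toward 0 on each side, whose
outermost positive (resp. negative) point lies on `ζ₊ q^ℤ` (resp. `ζ₋ q^ℤ`), and in which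
any two consecutive points of the same sign have ratio in `t q^{ℤ≥0}`. -/
def IsConfig (q t ζp ζm : ℝ) (X : Set ℝ) : Prop :=
  X.Countable ∧ (0 : ℝ) ∉ X ∧
  (∀ x ∈ X, 0 < x → {y ∈ X | x < y}.Finite) ∧
  (∀ x ∈ X, x < 0 → {y ∈ X | y < x}.Finite) ∧
  (∀ x ∈ X, 0 < x → (∀ y ∈ X, 0 < y → y ≤ x) → ∃ n : ℤ, x = ζp * q ^ n) ∧
  (∀ x ∈ X, x < 0 → (∀ y ∈ X, y < 0 → x ≤ y) → ∃ n : ℤ, x = ζm * q ^ n) ∧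
  (∀ x ∈ X, ∀ y ∈ X, 0 < y → y < x → (∀ z ∈ X, z ≤ y ∨ x ≤ z) → ∃ k : ℕ, y = x * t * q ^ k) ∧
  (∀ x ∈ X, ∀ y ∈ X, y < x → x < 0 → (∀ z ∈ X, z ≤ y ∨ x ≤ z) → ∃ k : ℕ, x = y * t * q ^ k)

/-- The set `Ω_N` of N-particle configurations, realized as finsets of reals. -/
def OmegaN (q t ζp ζm : ℝ) (N : ℕ) : Set (Finset ℝ) :=
  {X | X.card = N ∧ IsConfig q t ζp ζm ↑X}

/-- The (q,t)-interaction `V_{q,t}(X)`. -/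
noncomputable def Vqt (q t : ℝ) (X : Finset ℝ) : ℝ :=
  (∏ x ∈ X, ∏ y ∈ X, if y < x then (x - y) else 1) *
  (∏ x ∈ X, ∏ y ∈ X, if 0 < x ∧ y < x then
      x ^ (2 * Real.logb q t - 1) * qPochR q (q * t⁻¹ * y * x⁻¹) / qPochR q (t * y * x⁻¹)
    else 1) *
  (∏ x ∈ X, ∏ y ∈ X, if x < 0 ∧ y < x then
      |y| ^ (2 * Real.logb q t - 1) * qPochR q (q * t⁻¹ * x * y⁻¹) / qPochR q (t * x * y⁻¹)
    else 1)

/-- The constant `C_N(k) = ∏_{1≤i<j≤N, i≤k} ψ_τ(ζ₋ζ₊⁻¹ t^{N-i-j+1})`. -/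
noncomputable def CNconst (q t ζp ζm : ℝ) (N k : ℕ) : ℝ :=
  ∏ i ∈ Finset.Icc 1 N, ∏ j ∈ Finset.Icc 1 N,
    if i < j ∧ i ≤ k then psiQ q t (ζm * ζp⁻¹ * t ^ ((N : ℤ) - (i : ℤ) - (j : ℤ) + 1)) else 1

/-- The unnormalized N-particle weight
`M̃_N(X) = C_N(|X⁺|) V_{q,t}(X) ∏_{x∈X} W(x; q; a,b,c,d)`. -/
noncomputable def Mtilde (q t ζp ζm : ℝ) (N : ℕ) (a b c d : ℂ) (X : Finset ℝ) : ℂ :=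
  ((CNconst q t ζp ζm N (X.filter (fun x => 0 < x)).card * Vqt q t X : ℝ) : ℂ) *
    ∏ x ∈ X, Wc q a b c d x

section InfiniteProduct

variable {𝕜 : Type*} [RCLike 𝕜] {v : 𝕜}

lemma summable_neg_mul_pow (hv : ‖v‖ < 1) (u : 𝕜) : Summable fun n : ℕ => ‖-(u * v ^ n)‖ := by
  simpa using (summable_geometric_of_lt_one (norm_nonneg v) hv).mul_left ‖u‖

lemma multipliable_one_sub_mul_pow (hv : ‖v‖ < 1) (u : 𝕜) :
    Multipliable fun n : ℕ => 1 - u * v ^ n := by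
  simpa [sub_eq_add_neg] using multipliable_one_add_of_summable (summable_neg_mul_pow hv u)

lemma tprod_one_sub_mul_pow_eq (hv : ‖v‖ < 1) (u : 𝕜) :
    ∏' n : ℕ, (1 - u * v ^ n) = (1 - u) * ∏' n : ℕ, (1 - u * v * v ^ n) := by
  have e : (fun n : ℕ => 1 - u * v ^ (n + 1)) = fun n : ℕ => 1 - u * v * v ^ n := by
    funext n
    rw [pow_succ', mul_assoc]
  have h : Multipliable fun n : ℕ => 1 - u * v ^ (n + 1) :=
    e ▸ multipliable_one_sub_mul_pow hv (u * v)
  have h' := tprod_eq_zero_mul' (f := fun n : ℕ => 1 - u * v ^ n) h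
  rw [e, pow_zero, mul_one] at h'
  exact h'

lemma tprod_one_sub_mul_pow_ne_zero (hv : ‖v‖ < 1) {u : 𝕜} (hu : ∀ n : ℕ, 1 - u * v ^ n ≠ 0) :
    ∏' n : ℕ, (1 - u * v ^ n) ≠ 0 := by
  simpa [sub_eq_add_neg] using tprod_one_add_ne_zero_of_summable
    (f := fun n : ℕ => -(u * v ^ n)) (by simpa [sub_eq_add_neg] using hu)
    (summable_neg_mul_pow hv u)

lemma continuous_tprod_one_sub_mul_pow (hv : ‖v‖ < 1) :
    Continuous fun u : 𝕜 => ∏' n : ℕ, (1 - u * v ^ n) := by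
  refine continuous_iff_continuousAt.2 fun u₀ => ?_
  have h := Summable.hasProdLocallyUniformlyOn_nat_one_add
    (K := Metric.ball (0 : 𝕜) (‖u₀‖ + 1)) (f := fun (n : ℕ) (u : 𝕜) => -(u * v ^ n))
    (u := fun n => (‖u₀‖ + 1) * ‖v‖ ^ n) Metric.isOpen_ball
    ((summable_geometric_of_lt_one (norm_nonneg v) hv).mul_left _)
    (.of_forall fun n u hu => by
      rw [norm_neg, norm_mul, norm_pow]
      gcongr
      simpa using (mem_ball_zero_iff.1 hu).le)
    (fun n => by fun_prop)
  have hc : ContinuousOn (fun u : 𝕜 => ∏' n : ℕ, (1 + -(u * v ^ n)))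
      (Metric.ball (0 : 𝕜) (‖u₀‖ + 1)) := by
    refine (hasProdLocallyUniformlyOn_iff_tendstoLocallyUniformlyOn.1 h).continuousOn
      (.of_forall fun s => by fun_prop)
  simp only [← sub_eq_add_neg] at hc
  exact hc.continuousAt (Metric.isOpen_ball.mem_nhds (by simp))

end InfiniteProduct

section QPochhammer

variable {q : ℝ}

lemma norm_ofReal_lt_one (hq0 : 0 < q) (hq1 : q < 1) : ‖(q : ℂ)‖ < 1 := by
  simpa [abs_of_pos hq0] using hq1

lemma norm_lt_one_of_pos (hq0 : 0 < q) (hq1 : q < 1) : ‖q‖ < 1 := by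
  simpa [abs_of_pos hq0] using hq1

lemma qPochC_eq (hq0 : 0 < q) (hq1 : q < 1) (u : ℂ) :
    qPochC q u = (1 - u) * qPochC q (u * q) :=
  tprod_one_sub_mul_pow_eq (norm_ofReal_lt_one hq0 hq1) u

lemma qPochR_eq (hq0 : 0 < q) (hq1 : q < 1) (u : ℝ) :
    qPochR q u = (1 - u) * qPochR q (u * q) :=
  tprod_one_sub_mul_pow_eq (norm_lt_one_of_pos hq0 hq1) u

lemma continuous_qPochC (hq0 : 0 < q) (hq1 : q < 1) : Continuous (qPochC q) :=
  continuous_tprod_one_sub_mul_pow (norm_ofReal_lt_one hq0 hq1)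

lemma continuous_qPochR (hq0 : 0 < q) (hq1 : q < 1) : Continuous (qPochR q) :=
  continuous_tprod_one_sub_mul_pow (norm_lt_one_of_pos hq0 hq1)

lemma qPochC_ne_zero_s8 (hq0 : 0 < q) (hq1 : q < 1) {c : ℂ} (hc : c.im ≠ 0) (x : ℝ) :
    qPochC q (c * x) ≠ 0 := by
  refine tprod_one_sub_mul_pow_ne_zero (norm_ofReal_lt_one hq0 hq1) fun n h => ?_
  have him := congrArg Complex.im h
  have hre := congrArg Complex.re h
  norm_cast at him hre
  simp only [Complex.sub_im, Complex.mul_im, Complex.one_im, Complex.ofReal_re, Complex.ofReal_im,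
    Complex.sub_re, Complex.mul_re, Complex.one_re] at him hre
  have hqn : q ^ n ≠ 0 := (pow_pos hq0 n).ne'
  have hx : x = 0 := by simpa [hqn, hc] using him
  simp [hx] at hre

lemma qPochR_ne_zero (hq0 : 0 < q) (hq1 : q < 1) {u : ℝ} (hu : u < 1) : qPochR q u ≠ 0 := by
  refine tprod_one_sub_mul_pow_ne_zero (norm_lt_one_of_pos hq0 hq1) fun n => ?_
  have h0 : 0 < q ^ n := pow_pos hq0 n
  have h1 : q ^ n ≤ 1 := pow_le_one₀ hq0.le hq1.le
  nlinarith

end QPochhammer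

/-- A function that eventually does not increase under `u ↦ u / q` is bounded on `[1, ∞)`. -/
lemma exists_bound_of_eventually_le {q : ℝ} (hq0 : 0 < q) (hq1 : q < 1) {h : ℝ → ℝ}
    (hc : ContinuousOn h (Set.Ici 1)) (hev : ∀ᶠ u in Filter.atTop, h (u / q) ≤ h u) :
    ∃ C, ∀ u, 1 ≤ u → h u ≤ C := by
  obtain ⟨x₀, hx₁, hx₀⟩ : ∃ x₀ : ℝ, 1 ≤ x₀ ∧ ∀ u, x₀ ≤ u → h (u / q) ≤ h u := by
    obtain ⟨x, hx⟩ := Filter.eventually_atTop.1 hev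
    exact ⟨max 1 x, le_max_left _ _, fun u hu => hx u (le_of_max_le_right hu)⟩
  obtain ⟨C, hC⟩ := (isCompact_Icc (a := (1 : ℝ)) (b := x₀ / q)).bddAbove_image
    (hc.mono Set.Icc_subset_Ici_self)
  have hC' : ∀ u, 1 ≤ u → u ≤ x₀ / q → h u ≤ C := fun u h1 h2 => hC ⟨u, ⟨h1, h2⟩, rfl⟩
  have key : ∀ n : ℕ, ∀ u, 1 ≤ u → u * q ^ n ≤ x₀ / q → h u ≤ C := by
    intro n
    induction n with
    | zero => intro u h1 h2; exact hC' u h1 (by simpa using h2)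
    | succ n ih =>
      intro u h1 h2
      rcases le_or_gt u (x₀ / q) with h3 | h3
      · exact hC' u h1 h3
      · have h4 : x₀ ≤ u * q := ((div_lt_iff₀ hq0).1 h3).le
        have h5 := hx₀ (u * q) h4
        rw [mul_div_cancel_right₀ _ hq0.ne'] at h5
        exact h5.trans (ih _ (hx₁.trans h4) (by rwa [mul_assoc, ← pow_succ']))
  refine ⟨C, fun u hu => ?_⟩
  obtain ⟨n, hn⟩ := exists_pow_lt_of_lt_one (show 0 < x₀ / q / u by positivity) hq1
  refine key n u hu ?_
  rw [lt_div_iff₀ (by linarith)] at hn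
  linarith [mul_comm u (q ^ n)]

section Weight

variable {q : ℝ}

/-- The modulus of `(ax;q)_∞ (bx;q)_∞ / ((cx;q)_∞ (dx;q)_∞)`. -/
noncomputable def weightRatio (q : ℝ) (a b c d : ℂ) (x : ℝ) : ℝ :=
  ‖qPochC q (a * x)‖ * ‖qPochC q (b * x)‖ / (‖qPochC q (c * x)‖ * ‖qPochC q (d * x)‖)

lemma norm_Wc (hq1 : q < 1) (a b c d : ℂ) (x : ℝ) :
    ‖Wc q a b c d x‖ = (1 - q) * |x| * weightRatio q a b c d x := by
  have h : 0 ≤ 1 - q := by linarith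
  simp only [Wc, weightRatio, norm_div, norm_mul, Complex.norm_real, Real.norm_eq_abs,
    abs_abs, abs_of_nonneg h]
  ring

lemma weightRatio_neg (a b c d : ℂ) (x : ℝ) :
    weightRatio q a b c d (-x) = weightRatio q (-a) (-b) (-c) (-d) x := by
  simp [weightRatio]

lemma continuous_weightRatio (hq0 : 0 < q) (hq1 : q < 1) (a b : ℂ) {c d : ℂ} (hc : c.im ≠ 0)
    (hd : d.im ≠ 0) : Continuous (weightRatio q a b c d) := by
  have hP : ∀ e : ℂ, Continuous fun x : ℝ => ‖qPochC q (e * x)‖ := fun e =>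
    ((continuous_qPochC hq0 hq1).comp (by fun_prop)).norm
  refine ((hP a).mul (hP b)).div ((hP c).mul (hP d)) fun x => ?_
  exact mul_ne_zero (norm_ne_zero_iff.2 (qPochC_ne_zero_s8 hq0 hq1 hc x))
    (norm_ne_zero_iff.2 (qPochC_ne_zero_s8 hq0 hq1 hd x))

lemma weightRatio_div (hq0 : 0 < q) (hq1 : q < 1) (a b c d : ℂ) (u : ℝ) :
    weightRatio q a b c d (u / q) =
      ‖1 - a * (u / q : ℝ)‖ * ‖1 - b * (u / q : ℝ)‖ /
        (‖1 - c * (u / q : ℝ)‖ * ‖1 - d * (u / q : ℝ)‖) * weightRatio q a b c d u := by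
  have h : ∀ e : ℂ, ‖qPochC q (e * (u / q : ℝ))‖ = ‖1 - e * (u / q : ℝ)‖ * ‖qPochC q (e * u)‖ := by
    intro e
    rw [qPochC_eq hq0 hq1, norm_mul]
    congr 3
    have : (q : ℂ) ≠ 0 := by exact_mod_cast hq0.ne'
    push_cast
    field_simp
  simp only [weightRatio, h]
  rw [div_mul_div_comm]
  congr 1 <;> ring

lemma tendsto_norm_inv_sub (e : ℂ) :
    Filter.Tendsto (fun x : ℝ => ‖((x⁻¹ : ℝ) : ℂ) - e‖) Filter.atTop (nhds ‖e‖) := by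
  have h : Filter.Tendsto (fun x : ℝ => ((x⁻¹ : ℝ) : ℂ)) Filter.atTop (nhds ((0 : ℝ) : ℂ)) :=
    (Complex.continuous_ofReal.tendsto 0).comp tendsto_inv_atTop_zero
  simpa using (h.sub_const e).norm

lemma norm_one_sub_mul {x : ℝ} (hx : 0 < x) (e : ℂ) :
    ‖1 - e * x‖ = x * ‖((x⁻¹ : ℝ) : ℂ) - e‖ := by
  have hx' : (x : ℂ) ≠ 0 := by exact_mod_cast hx.ne'
  have : 1 - e * x = x * (((x⁻¹ : ℝ) : ℂ) - e) := by
    push_cast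
    field_simp
  rw [this, norm_mul, Complex.norm_real, Real.norm_eq_abs, abs_of_pos hx]

lemma eventually_norm_mul_le {a b c d : ℂ} {ρ : ℝ} (h : ‖a‖ * ‖b‖ < ρ * (‖c‖ * ‖d‖)) :
    ∀ᶠ x : ℝ in Filter.atTop,
      ‖1 - a * x‖ * ‖1 - b * x‖ ≤ ρ * (‖1 - c * x‖ * ‖1 - d * x‖) := by
  have h1 := (tendsto_norm_inv_sub a).mul (tendsto_norm_inv_sub b)
  have h2 := ((tendsto_norm_inv_sub c).mul (tendsto_norm_inv_sub d)).const_mul ρ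
  filter_upwards [h1.eventually_lt h2 h, Filter.eventually_gt_atTop 0] with x hx hx0
  simp only [norm_one_sub_mul hx0]
  nlinarith [mul_pos hx0 hx0]

lemma exists_weightRatio_bound_of_nonneg (hq0 : 0 < q) (hq1 : q < 1) {a b c d : ℂ}
    (hc : c.im ≠ 0) (hd : d.im ≠ 0) {σ : ℝ} (h : ‖a‖ * ‖b‖ < q ^ σ * (‖c‖ * ‖d‖)) :
    ∃ C, ∀ x, 0 ≤ x → weightRatio q a b c d x * max 1 x ^ σ ≤ C := by
  have hcont := continuous_weightRatio hq0 hq1 a b hc hd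
  obtain ⟨C₁, hC₁⟩ := exists_bound_of_eventually_le hq0 hq1
    (h := fun u => weightRatio q a b c d u * u ^ σ)
    (hcont.continuousOn.mul (continuousOn_id.rpow_const fun x hx =>
      Or.inl (lt_of_lt_of_le one_pos hx).ne')) (by
      have hdiv : Filter.Tendsto (fun u : ℝ => u / q) Filter.atTop Filter.atTop :=
        Filter.tendsto_id.atTop_div_const hq0
      filter_upwards [hdiv.eventually (eventually_norm_mul_le h), Filter.eventually_gt_atTop 0]
        with u hu hu0
      have hne : ∀ {e : ℂ}, e.im ≠ 0 → 0 < ‖1 - e * (u / q : ℝ)‖ := by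
        intro e he
        rw [norm_pos_iff]
        intro h0
        have him := congrArg Complex.im h0
        rw [Complex.sub_im, Complex.im_mul_ofReal] at him
        simp [he, hu0.ne', hq0.ne'] at him
      have hpos : 0 < ‖1 - c * (u / q : ℝ)‖ * ‖1 - d * (u / q : ℝ)‖ := mul_pos (hne hc) (hne hd)
      have hr := (div_le_iff₀ hpos).2 hu
      have hσ : 0 < q ^ σ := Real.rpow_pos_of_pos hq0 σ
      have hg : 0 ≤ weightRatio q a b c d u := by unfold weightRatio; positivity
      rw [weightRatio_div hq0 hq1, Real.div_rpow hu0.le hq0.le]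
      calc _ ≤ q ^ σ * weightRatio q a b c d u * (u ^ σ / q ^ σ) := by gcongr
        _ = _ := by field_simp)
  obtain ⟨C₂, hC₂⟩ := (isCompact_Icc (a := (0 : ℝ)) (b := 1)).bddAbove_image hcont.continuousOn
  refine ⟨max C₁ C₂, fun x hx => ?_⟩
  rcases le_total 1 x with h1 | h1
  · rw [max_eq_right h1]
    exact (hC₁ x h1).trans (le_max_left _ _)
  · rw [max_eq_left h1, Real.one_rpow, mul_one]
    exact (hC₂ ⟨x, ⟨hx, h1⟩, rfl⟩).trans (le_max_right _ _)

lemma exists_norm_Wc_bound (hq0 : 0 < q) (hq1 : q < 1) {a b c d : ℂ}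
    (hc : c.im ≠ 0) (hd : d.im ≠ 0) {σ : ℝ} (h : ‖a‖ * ‖b‖ < q ^ σ * (‖c‖ * ‖d‖)) :
    ∃ C, 0 ≤ C ∧ ∀ x : ℝ, ‖Wc q a b c d x‖ * max 1 |x| ^ σ ≤ C * |x| := by
  obtain ⟨C₁, hC₁⟩ := exists_weightRatio_bound_of_nonneg hq0 hq1 hc hd h
  obtain ⟨C₂, hC₂⟩ := exists_weightRatio_bound_of_nonneg hq0 hq1 (a := -a) (b := -b) (c := -c)
    (d := -d) (by simpa using hc) (by simpa using hd) (by simpa using h)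
  have key : ∀ x : ℝ, weightRatio q a b c d x * max 1 |x| ^ σ ≤ max C₁ C₂ := by
    intro x
    rcases le_total 0 x with hx | hx
    · rw [abs_of_nonneg hx]
      exact (hC₁ x hx).trans (le_max_left _ _)
    · rw [abs_of_nonpos hx, ← neg_neg x, weightRatio_neg, neg_neg]
      exact (hC₂ (-x) (by linarith)).trans (le_max_right _ _)
  have h1 : 0 < 1 - q := by linarith
  have h0 : 0 ≤ max C₁ C₂ := le_trans (by unfold weightRatio; positivity) (key 0)
  refine ⟨(1 - q) * max C₁ C₂, by positivity, fun x => ?_⟩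
  rw [norm_Wc hq1]
  calc _ = (1 - q) * |x| * (weightRatio q a b c d x * max 1 |x| ^ σ) := by ring
    _ ≤ (1 - q) * |x| * max C₁ C₂ := by gcongr; exact key x
    _ = _ := by ring

end Weight

section Interaction

variable {q t : ℝ}

/-- The two-particle factor `(q t⁻¹ v;q)_∞ / (t v;q)_∞` as a function of the ratio `v`. -/
noncomputable def pairRatio (q t v : ℝ) : ℝ := qPochR q (q * t⁻¹ * v) / qPochR q (t * v)

lemma one_le_qPochR_neg (hq0 : 0 < q) (hq1 : q < 1) {w : ℝ} (hw : 0 ≤ w) : 1 ≤ qPochR q (-w) := by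
  refine ge_of_tendsto' (multipliable_one_sub_mul_pow (norm_lt_one_of_pos hq0 hq1) (-w)).hasProd
    fun s => Finset.prod_induction _ (1 ≤ ·) (fun _ _ => one_le_mul_of_one_le_of_one_le) le_rfl
      fun n _ => ?_
  have : 0 ≤ w * q ^ n := by positivity
  linarith

lemma continuousOn_pairRatio (hq0 : 0 < q) (hq1 : q < 1) (ht0 : 0 < t) (ht1 : t < 1) :
    ContinuousOn (pairRatio q t) (Set.Iic t) := by
  have hc := continuous_qPochR hq0 hq1
  refine ContinuousOn.div (hc.comp (by fun_prop)).continuousOn (hc.comp (by fun_prop)).continuousOn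
    fun v hv => qPochR_ne_zero hq0 hq1 ?_
  have : v ≤ t := hv
  nlinarith

lemma pairRatio_neg_div (hq0 : 0 < q) (hq1 : q < 1) (ht0 : 0 < t) (u : ℝ) :
    pairRatio q t (-(u / q)) = (1 + u / t) / (1 + t * u / q) * pairRatio q t (-u) := by
  unfold pairRatio
  rw [qPochR_eq hq0 hq1 (q * t⁻¹ * -(u / q)), qPochR_eq hq0 hq1 (t * -(u / q)), div_mul_div_comm]
  congr 2
  · field_simp; ring
  · congr 1; field_simp
  · field_simp; ring
  · congr 1; field_simp

lemma exists_pairRatio_bound (hq0 : 0 < q) (hq1 : q < 1) (ht0 : 0 < t) (ht1 : t < 1) {s : ℝ}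
    (hs : q ^ s = t ^ 2) :
    ∃ C, ∀ v, v ≤ t → (1 - v) * |pairRatio q t v| ≤ C * max 1 |v| ^ s := by
  have hc := continuous_qPochR hq0 hq1
  have hpc := continuousOn_pairRatio hq0 hq1 ht0 ht1
  obtain ⟨C₁, hC₁⟩ := exists_bound_of_eventually_le hq0 hq1
    (h := fun u => |pairRatio q t (-u)| * qPochR q (-(t / u)) * u ^ (1 - s)) (by
      have hne : ∀ u ∈ Set.Ici (1 : ℝ), u ≠ 0 := fun u hu => (lt_of_lt_of_le one_pos hu).ne'
      refine ((hpc.comp (by fun_prop) ?_).abs.mul (hc.comp_continuousOn ?_)).mul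
        (continuousOn_id.rpow_const fun x hx => Or.inl (hne x hx))
      · intro u hu
        have : (1 : ℝ) ≤ u := hu
        simp only [Set.mem_Iic]
        linarith
      · exact (continuousOn_const.div continuousOn_id hne).neg) (by
      filter_upwards [Filter.eventually_gt_atTop 0] with u hu0
      have e1 : qPochR q (-(t / u)) = (1 + t / u) * qPochR q (-(t / (u / q))) := by
        rw [qPochR_eq hq0 hq1]
        congr 2
        · ring
        · field_simp
      have hP : 0 ≤ qPochR q (-(t / (u / q))) :=
        zero_le_one.trans (one_le_qPochR_neg hq0 hq1 (by positivity))
      have hpos : 0 ≤ (1 + u / t) / (1 + t * u / q) := by positivity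
      have e2 : (u / q) ^ (1 - s) = u ^ (1 - s) * (t ^ 2 / q) := by
        rw [Real.div_rpow hu0.le hq0.le, Real.rpow_sub hq0, Real.rpow_one, hs]
        field_simp
      rw [pairRatio_neg_div hq0 hq1 ht0, abs_mul, abs_of_nonneg hpos, e1, e2]
      have e3 : (1 + u / t) / (1 + t * u / q) * (t ^ 2 / q) ≤ 1 + t / u := by
        rw [div_mul_eq_mul_div, div_le_iff₀ (by positivity)]
        have : (1 + t / u) * (1 + t * u / q) - (1 + u / t) * (t ^ 2 / q) = 1 + t / u := by
          field_simp
          ring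
        have : 0 < t / u := by positivity
        linarith
      calc _ = (1 + u / t) / (1 + t * u / q) * (t ^ 2 / q) *
            (|pairRatio q t (-u)| * qPochR q (-(t / (u / q))) * u ^ (1 - s)) := by ring
        _ ≤ (1 + t / u) *
            (|pairRatio q t (-u)| * qPochR q (-(t / (u / q))) * u ^ (1 - s)) := by gcongr
        _ = _ := by ring)
  obtain ⟨C₂, hC₂⟩ := (isCompact_Icc (a := (-1 : ℝ)) (b := t)).bddAbove_image
    (f := fun v => (1 - v) * |pairRatio q t v|)
    (ContinuousOn.mul (by fun_prop) (hpc.mono Set.Icc_subset_Iic_self).abs)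
  refine ⟨max (2 * C₁) C₂, fun v hv => ?_⟩
  rcases le_total (-1) v with h1 | h1
  · rw [max_eq_left (abs_le.2 ⟨h1, by linarith⟩), Real.one_rpow, mul_one]
    exact (hC₂ ⟨v, ⟨h1, hv⟩, rfl⟩).trans (le_max_right _ _)
  · obtain ⟨u, rfl⟩ : ∃ u, v = -u := ⟨-v, by ring⟩
    have hu : 1 ≤ u := by linarith
    have hu0 : 0 < u := by linarith
    have hP := one_le_qPochR_neg hq0 hq1 (w := t / u) (by positivity)
    have hb := hC₁ u hu
    have hus : u = u ^ (1 - s) * u ^ s := by rw [← Real.rpow_add hu0]; simp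
    rw [abs_neg, abs_of_pos hu0, max_eq_right hu, sub_neg_eq_add]
    calc (1 + u) * |pairRatio q t (-u)| ≤ (u + u) * |pairRatio q t (-u)| := by gcongr
      _ = 2 * (|pairRatio q t (-u)| * 1 * u ^ (1 - s)) * u ^ s := by
        linear_combination (2 * |pairRatio q t (-u)|) * hus
      _ ≤ 2 * (|pairRatio q t (-u)| * qPochR q (-(t / u)) * u ^ (1 - s)) * u ^ s := by gcongr
      _ ≤ 2 * C₁ * u ^ s := by gcongr
      _ ≤ _ := by gcongr; exact le_max_left _ _

end Interaction

section Configuration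

variable {ζ q t : ℝ} {S : Finset ℝ}

lemma le_mul_of_consecutive (hq0 : 0 < q) (hq1 : q < 1) (ht0 : 0 < t)
    (hpos : ∀ x ∈ S, 0 < x)
    (hcons : ∀ x ∈ S, ∀ y ∈ S, y < x → (∀ z ∈ S, z ≤ y ∨ x ≤ z) → ∃ k : ℕ, y = x * t * q ^ k)
    {x y : ℝ} (hx : x ∈ S) (hy : y ∈ S) (hyx : y < x) : y ≤ x * t := by
  have hne : (S.filter (· < x)).Nonempty := ⟨y, by simp [hy, hyx]⟩
  have hzm := Finset.max'_mem _ hne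
  set z := (S.filter (· < x)).max' hne
  rw [Finset.mem_filter] at hzm
  obtain ⟨k, hk⟩ := hcons x hx z hzm.1 hzm.2 fun w hw => by
    rcases lt_or_ge w x with h | h
    · exact Or.inl (Finset.le_max' _ _ (by simp [hw, h]))
    · exact Or.inr h
  calc y ≤ z := Finset.le_max' _ _ (by simp [hy, hyx])
    _ = x * t * q ^ k := hk
    _ ≤ x * t * 1 := by
      have := hpos x hx
      gcongr
      exact pow_le_one₀ hq0.le hq1.le
    _ = x * t := mul_one _

lemma exists_eq_of_consecutive
    (hout : ∀ x ∈ S, (∀ y ∈ S, y ≤ x) → ∃ n : ℤ, x = ζ * q ^ n) (hq0 : 0 < q)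
    (hcons : ∀ x ∈ S, ∀ y ∈ S, y < x → (∀ z ∈ S, z ≤ y ∨ x ≤ z) → ∃ k : ℕ, y = x * t * q ^ k)
    {x : ℝ} (hx : x ∈ S) : ∃ j < S.card, ∃ n : ℤ, x = ζ * t ^ j * q ^ n := by
  suffices H : ∀ m : ℕ, ∀ x ∈ S, (S.filter (x < ·)).card = m →
      ∃ j ≤ m, ∃ n : ℤ, x = ζ * t ^ j * q ^ n by
    obtain ⟨j, hj, n, h⟩ := H _ x hx rfl
    exact ⟨j, hj.trans_lt (Finset.card_lt_card (Finset.filter_ssubset.2 ⟨x, hx, lt_irrefl x⟩)),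
      n, h⟩
  intro m
  induction m using Nat.strong_induction_on with
  | _ m ih =>
    intro x hx hm
    rcases (S.filter (x < ·)).eq_empty_or_nonempty with he | hne
    · obtain ⟨n, hn⟩ := hout x hx fun y hy => not_lt.1 fun h => by
        simpa using Finset.filter_eq_empty_iff.1 he hy h
      exact ⟨0, Nat.zero_le _, n, by simpa using hn⟩
    · have hzm := Finset.min'_mem _ hne
      set z := (S.filter (x < ·)).min' hne
      rw [Finset.mem_filter] at hzm
      have hcard : (S.filter (z < ·)).card < m := by
        rw [← hm]
        refine Finset.card_lt_card ((Finset.ssubset_iff_of_subset ?_).2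
          ⟨z, by simp [hzm.1, hzm.2], by simp⟩)
        intro w hw
        rw [Finset.mem_filter] at hw ⊢
        exact ⟨hw.1, hzm.2.trans hw.2⟩
      obtain ⟨j, hj, n, hn⟩ := ih _ hcard z hzm.1 rfl
      obtain ⟨k, hk⟩ := hcons z hzm.1 x hx hzm.2 fun w hw => by
        rcases lt_or_ge x w with h | h
        · exact Or.inr (Finset.min'_le _ _ (by simp [hw, h]))
        · exact Or.inl h
      refine ⟨j + 1, by omega, n + k, ?_⟩
      rw [hk, hn, zpow_add₀ hq0.ne', zpow_natCast]
      ring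

/-- The union of the lattices `ζ₊ t^j q^ℤ` and `ζ₋ t^j q^ℤ` over `j < N`. -/
def latticeUnion (q t ζp ζm : ℝ) (N : ℕ) : Set ℝ :=
  {x | ∃ j < N, ∃ n : ℤ, x = ζp * t ^ j * q ^ n ∨ x = ζm * t ^ j * q ^ n}

variable {ζp ζm : ℝ} {N : ℕ} {X : Finset ℝ}

/-- The conditions on the positive part of a configuration. -/
lemma positive_part_of_isConfig (h : IsConfig q t ζp ζm ↑X) :
    (∀ x ∈ X.filter (0 < ·), (∀ y ∈ X.filter (0 < ·), y ≤ x) → ∃ n : ℤ, x = ζp * q ^ n) ∧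
    (∀ x ∈ X.filter (0 < ·), ∀ y ∈ X.filter (0 < ·), y < x →
      (∀ z ∈ X.filter (0 < ·), z ≤ y ∨ x ≤ z) → ∃ k : ℕ, y = x * t * q ^ k) := by
  obtain ⟨-, -, -, -, hop, -, hcp, -⟩ := h
  simp only [Finset.mem_coe] at hop hcp
  simp only [Finset.mem_filter]
  refine ⟨fun x hx hm => hop x hx.1 hx.2 fun y hy hy0 => hm y ⟨hy, hy0⟩,
    fun x hx y hy hyx hz => hcp x hx.1 y hy.1 hy.2 hyx fun z hzX => ?_⟩
  rcases lt_or_ge 0 z with h0 | h0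
  · exact hz z ⟨hzX, h0⟩
  · exact Or.inl (h0.trans hy.2.le)

lemma isConfig_image_neg (h : IsConfig q t ζp ζm ↑X) :
    IsConfig q t (-ζm) (-ζp) ↑(X.image Neg.neg) := by
  have hmem : ∀ x, x ∈ X.image Neg.neg ↔ -x ∈ X := fun x => by
    simp [neg_eq_iff_eq_neg]
  obtain ⟨-, h0, -, -, hop, hom, hcp, hcm⟩ := h
  simp only [Finset.mem_coe] at h0 hop hom hcp hcm
  refine ⟨(Finset.finite_toSet _).countable, ?_, fun _ _ _ => (Finset.finite_toSet _).subset
    (Set.sep_subset _ _), fun _ _ _ => (Finset.finite_toSet _).subset (Set.sep_subset _ _),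
    ?_, ?_, ?_, ?_⟩
  all_goals simp only [Finset.mem_coe, hmem]
  · simpa using h0
  · intro x hx hx0 hm
    obtain ⟨n, hn⟩ := hom (-x) hx (by linarith) fun y hy hy0 => by
      linarith [hm (-y) (by simpa using hy) (by linarith)]
    exact ⟨n, by linarith⟩
  · intro x hx hx0 hm
    obtain ⟨n, hn⟩ := hop (-x) hx (by linarith) fun y hy hy0 => by
      linarith [hm (-y) (by simpa using hy) (by linarith)]
    exact ⟨n, by linarith⟩
  · intro x hx y hy hy0 hyx hz
    obtain ⟨k, hk⟩ := hcm (-y) hy (-x) hx (by linarith) (by linarith) fun z hzX => by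
      rcases hz (-z) (by simpa using hzX) with h | h
      · right; linarith
      · left; linarith
    exact ⟨k, by linarith⟩
  · intro x hx y hy hyx hx0 hz
    obtain ⟨k, hk⟩ := hcp (-y) hy (-x) hx (by linarith) (by linarith) fun z hzX => by
      rcases hz (-z) (by simpa using hzX) with h | h
      · right; linarith
      · left; linarith
    exact ⟨k, by linarith⟩

lemma le_mul_of_isConfig (hq0 : 0 < q) (hq1 : q < 1) (ht0 : 0 < t)
    (h : IsConfig q t ζp ζm ↑X) {x y : ℝ} (hx : x ∈ X) (hy : y ∈ X) (hx0 : 0 < x)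
    (hyx : y < x) : y ≤ x * t := by
  rcases lt_or_ge 0 y with hy0 | hy0
  · exact le_mul_of_consecutive hq0 hq1 ht0 (fun z hz => (Finset.mem_filter.1 hz).2)
      (positive_part_of_isConfig h).2 (by simp [hx, hx0]) (by simp [hy, hy0]) hyx
  · exact hy0.trans (by positivity)

lemma exists_eq_of_isConfig (hq0 : 0 < q) (h : IsConfig q t ζp ζm ↑X) {x : ℝ} (hx : x ∈ X)
    (hx0 : 0 < x) : ∃ j < X.card, ∃ n : ℤ, x = ζp * t ^ j * q ^ n := by
  obtain ⟨j, hj, hn⟩ := exists_eq_of_consecutive (positive_part_of_isConfig h).1 hq0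
    (positive_part_of_isConfig h).2 (show x ∈ X.filter (0 < ·) by simp [hx, hx0])
  exact ⟨j, hj.trans_le (Finset.card_filter_le _ _), hn⟩

lemma mem_latticeUnion_of_isConfig (hq0 : 0 < q) (h : IsConfig q t ζp ζm ↑X) {x : ℝ}
    (hx : x ∈ X) : x ∈ latticeUnion q t ζp ζm X.card := by
  rcases lt_trichotomy x 0 with hx0 | hx0 | hx0
  · obtain ⟨j, hj, n, hn⟩ := exists_eq_of_isConfig hq0 (isConfig_image_neg h)
      (x := -x) (by simpa using hx) (by linarith)
    rw [Finset.card_image_of_injective _ neg_injective] at hj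
    exact ⟨j, hj, n, Or.inr (by linarith)⟩
  · exact absurd (hx0 ▸ hx) h.2.1
  · obtain ⟨j, hj, n, hn⟩ := exists_eq_of_isConfig hq0 h hx hx0
    exact ⟨j, hj, n, Or.inl hn⟩

/-- The envelope `min (|x|, |x|^{-δ})` of the one-particle weight. -/
noncomputable def envelope (δ x : ℝ) : ℝ := min |x| (|x| ^ (-δ))

lemma envelope_nonneg (δ x : ℝ) : 0 ≤ envelope δ x := by
  unfold envelope
  positivity

lemma summable_envelope_zpow (hq0 : 0 < q) (hq1 : q < 1) {δ : ℝ} (hδ : 0 < δ) (A : ℝ) :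
    Summable fun n : ℤ => envelope δ (A * q ^ n) := by
  refine Summable.of_nat_of_neg ?_ ?_
  · refine Summable.of_nonneg_of_le (fun n => envelope_nonneg _ _) (fun n => ?_)
      ((summable_geometric_of_lt_one hq0.le hq1).mul_left |A|)
    refine (min_le_left _ _).trans_eq ?_
    rw [abs_mul, zpow_natCast, abs_of_pos (pow_pos hq0 n)]
  · refine Summable.of_nonneg_of_le (fun n => envelope_nonneg _ _) (fun n => ?_)
      ((summable_geometric_of_lt_one (Real.rpow_nonneg hq0.le δ)
        (Real.rpow_lt_one hq0.le hq1 hδ)).mul_left (|A| ^ (-δ)))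
    refine (min_le_right _ _).trans_eq ?_
    have hqn := pow_pos hq0 n
    rw [abs_mul, zpow_neg, zpow_natCast, abs_of_pos (inv_pos.2 hqn),
      Real.mul_rpow (abs_nonneg A) (inv_pos.2 hqn).le, Real.inv_rpow hqn.le,
      Real.rpow_neg hqn.le, inv_inv, ← Real.rpow_natCast, ← Real.rpow_natCast,
      ← Real.rpow_mul hq0.le, ← Real.rpow_mul hq0.le, mul_comm δ]

lemma summable_indicator_range_envelope (hq0 : 0 < q) (hq1 : q < 1) {δ : ℝ} (hδ : 0 < δ)
    {A : ℝ} (hA : A ≠ 0) :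
    Summable ((Set.range fun n : ℤ => A * q ^ n).indicator (envelope δ)) := by
  have hinj : Function.Injective fun n : ℤ => A * q ^ n :=
    (mul_right_injective₀ hA).comp (zpow_right_injective₀ hq0 hq1.ne)
  refine (hinj.summable_iff fun x hx => Set.indicator_of_notMem hx _).1 ?_
  refine (summable_envelope_zpow hq0 hq1 hδ A).congr fun n => ?_
  exact (Set.indicator_of_mem (s := Set.range fun n : ℤ => A * q ^ n) ⟨n, rfl⟩ _).symm

lemma summable_indicator_latticeUnion (hq0 : 0 < q) (hq1 : q < 1) (ht0 : 0 < t) (hζp : ζp ≠ 0)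
    (hζm : ζm ≠ 0) {δ : ℝ} (hδ : 0 < δ) (N : ℕ) :
    Summable ((latticeUnion q t ζp ζm N).indicator (envelope δ)) := by
  have hnn : ∀ (s : Set ℝ) (x : ℝ), 0 ≤ s.indicator (envelope δ) x := fun s x =>
    Set.indicator_nonneg (fun y _ => envelope_nonneg δ y) x
  have htj : ∀ j : ℕ, t ^ j ≠ 0 := fun j => (pow_pos ht0 j).ne'
  have hsum := summable_sum (s := Finset.range N)
    (f := fun (j : ℕ) (x : ℝ) =>
      (Set.range fun n : ℤ => ζp * t ^ j * q ^ n).indicator (envelope δ) x +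
      (Set.range fun n : ℤ => ζm * t ^ j * q ^ n).indicator (envelope δ) x)
    fun j _ => (summable_indicator_range_envelope hq0 hq1 hδ (mul_ne_zero hζp (htj j))).add
      (summable_indicator_range_envelope hq0 hq1 hδ (mul_ne_zero hζm (htj j)))
  refine Summable.of_nonneg_of_le (hnn _) (fun x => ?_) hsum
  by_cases hx : x ∈ latticeUnion q t ζp ζm N
  · obtain ⟨j, hj, n, hn⟩ := id hx
    rw [Set.indicator_of_mem hx]
    refine le_trans ?_ (Finset.single_le_sum
      (f := fun j : ℕ => (Set.range fun n : ℤ => ζp * t ^ j * q ^ n).indicator (envelope δ) x +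
        (Set.range fun n : ℤ => ζm * t ^ j * q ^ n).indicator (envelope δ) x)
      (fun i _ => add_nonneg (hnn _ _) (hnn _ _)) (Finset.mem_range.2 hj))
    rcases hn with hn | hn
    · have hr : x ∈ Set.range fun n : ℤ => ζp * t ^ j * q ^ n := ⟨n, hn.symm⟩
      refine le_add_of_le_of_nonneg ?_ (hnn _ _)
      rw [Set.indicator_of_mem hr]
    · have hr : x ∈ Set.range fun n : ℤ => ζm * t ^ j * q ^ n := ⟨n, hn.symm⟩
      refine le_add_of_nonneg_of_le (hnn _ _) ?_
      rw [Set.indicator_of_mem hr]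
  · rw [Set.indicator_of_notMem hx]
    exact Finset.sum_nonneg fun i _ => add_nonneg (hnn _ _) (hnn _ _)

end Configuration

section Assembly

variable {q t ζp ζm : ℝ}

lemma abs_pair_le (hq0 : 0 < q) (hq1 : q < 1) (ht0 : 0 < t) (ht1 : t < 1) {s : ℝ} (hs0 : 0 ≤ s)
    (hs : q ^ s = t ^ 2) :
    ∃ C, 1 ≤ C ∧ ∀ x y : ℝ, 0 < x → y ≤ x * t →
      |(x - y) * (x ^ (s - 1) * qPochR q (q * t⁻¹ * y * x⁻¹) / qPochR q (t * y * x⁻¹))| ≤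
        C * (max 1 |x| ^ s * max 1 |y| ^ s) := by
  obtain ⟨C, hC⟩ := exists_pairRatio_bound hq0 hq1 ht0 ht1 hs
  refine ⟨max 1 C, le_max_left _ _, fun x y hx hy => ?_⟩
  have hv : y / x ≤ t := (div_le_iff₀ hx).2 (by linarith)
  have hv1 : 0 ≤ 1 - y / x := by linarith
  have e : (x - y) * (x ^ (s - 1) * qPochR q (q * t⁻¹ * y * x⁻¹) / qPochR q (t * y * x⁻¹)) =
      x ^ s * ((1 - y / x) * pairRatio q t (y / x)) := by
    rw [pairRatio, Real.rpow_sub hx, Real.rpow_one, mul_assoc (q * t⁻¹), mul_assoc t,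
      ← div_eq_mul_inv]
    field_simp
  have hxs : 0 ≤ x ^ s := Real.rpow_nonneg hx.le s
  rw [e, abs_mul, abs_mul, abs_of_nonneg hxs, abs_of_nonneg hv1]
  have hm : x * max 1 |y / x| ≤ max 1 |x| * max 1 |y| := by
    rw [abs_div, abs_of_pos hx, mul_max_of_nonneg _ _ hx.le, mul_div_cancel₀ _ hx.ne', mul_one]
    refine max_le ?_ ?_
    · exact (le_max_right 1 x).trans (le_mul_of_one_le_right (by positivity) (le_max_left _ _))
    · exact (le_max_right 1 |y|).trans (le_mul_of_one_le_left (by positivity) (le_max_left _ _))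
  calc _ ≤ x ^ s * (C * max 1 |y / x| ^ s) :=
        mul_le_mul_of_nonneg_left (hC _ hv) hxs
    _ ≤ x ^ s * (max 1 C * max 1 |y / x| ^ s) := by gcongr; exact le_max_right _ _
    _ = max 1 C * (x * max 1 |y / x|) ^ s := by
      rw [Real.mul_rpow hx.le (by positivity)]; ring
    _ ≤ max 1 C * (max 1 |x| * max 1 |y|) ^ s := by gcongr
    _ = _ := by
      rw [abs_of_pos hx, Real.mul_rpow (by positivity) (by positivity)]

lemma prod_prod_pair (X : Finset ℝ) (M : ℝ → ℝ) :
    ∏ x ∈ X, ∏ y ∈ X, (if y < x then M x * M y else 1) = ∏ x ∈ X, M x ^ (X.card - 1) := by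
  have h1 : ∏ x ∈ X, ∏ y ∈ X, (if y < x then M x * M y else 1) =
      (∏ x ∈ X, ∏ y ∈ X, if y < x then M x else 1) *
        ∏ x ∈ X, ∏ y ∈ X, if y < x then M y else 1 := by
    simp only [← Finset.prod_mul_distrib]
    refine Finset.prod_congr rfl fun x _ => Finset.prod_congr rfl fun y _ => ?_
    split_ifs <;> simp
  rw [h1, Finset.prod_comm (f := fun x y => if y < x then M y else 1), ← Finset.prod_mul_distrib]
  refine Finset.prod_congr rfl fun x hx => ?_
  rw [← Finset.prod_mul_distrib, ← Finset.card_erase_of_mem hx, ← Finset.prod_const,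
    ← Finset.mul_prod_erase X _ hx]
  simp only [lt_irrefl, if_false, one_mul]
  refine Finset.prod_congr rfl fun y hy => ?_
  rcases lt_or_gt_of_ne (Finset.ne_of_mem_erase hy) with h | h
  · simp [h, h.not_gt]
  · simp [h, h.not_gt]

lemma exists_Vqt_bound (hq0 : 0 < q) (hq1 : q < 1) (ht0 : 0 < t) (ht1 : t < 1) {N : ℕ}
    (hN : 1 ≤ N) :
    ∃ C, 0 ≤ C ∧ ∀ X ∈ OmegaN q t ζp ζm N,
      |Vqt q t X| ≤ C * ∏ x ∈ X, max 1 |x| ^ (2 * Real.logb q t * ((N : ℝ) - 1)) := by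
  have hs0 : 0 ≤ 2 * Real.logb q t :=
    mul_nonneg zero_le_two (Real.logb_nonneg_of_base_lt_one hq0 hq1 ht0 ht1.le)
  have hs : q ^ (2 * Real.logb q t) = t ^ 2 := by
    rw [mul_comm, Real.rpow_mul hq0.le, Real.rpow_logb hq0 hq1.ne ht0, Real.rpow_two]
  obtain ⟨K, hK1, hK⟩ := abs_pair_le hq0 hq1 ht0 ht1 hs0 hs
  set s := 2 * Real.logb q t
  refine ⟨K ^ (N * N), by positivity, fun X hX => ?_⟩
  obtain ⟨hcard, hconf⟩ := hX
  have hx0 : ∀ x ∈ X, x ≠ 0 := fun x hx h => hconf.2.1 (h ▸ hx)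
  set M : ℝ → ℝ := fun x => max 1 |x| ^ s with hM
  have hM0 : ∀ x, 0 ≤ M x := fun x => by positivity
  have hpair : ∀ x ∈ X, ∀ y ∈ X,
      |(if y < x then (x - y) else 1) *
        (if 0 < x ∧ y < x then
          x ^ (s - 1) * qPochR q (q * t⁻¹ * y * x⁻¹) / qPochR q (t * y * x⁻¹) else 1) *
        (if x < 0 ∧ y < x then
          |y| ^ (s - 1) * qPochR q (q * t⁻¹ * x * y⁻¹) / qPochR q (t * x * y⁻¹) else 1)| ≤
        K * (if y < x then M x * M y else 1) := by
    intro x hx y hy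
    by_cases hyx : y < x
    · rcases lt_or_gt_of_ne (hx0 x hx) with h | h
      · have hb := hK (-y) (-x) (by linarith)
          (le_mul_of_isConfig hq0 hq1 ht0 (isConfig_image_neg hconf) (by simpa using hy)
            (by simpa using hx) (by linarith) (by linarith))
        rw [show q * t⁻¹ * -x * (-y)⁻¹ = q * t⁻¹ * x * y⁻¹ by rw [inv_neg]; ring,
          show t * -x * (-y)⁻¹ = t * x * y⁻¹ by rw [inv_neg]; ring,
          show -y - -x = x - y by ring, abs_neg, abs_neg] at hb
        simp only [hyx, h, h.not_gt, false_and, and_self, if_true, if_false, mul_one]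
        rw [abs_of_neg (hyx.trans h)] at hb ⊢
        refine hb.trans_eq ?_
        simp only [hM, abs_of_neg (hyx.trans h)]
        ring
      · simp only [hyx, h, h.not_gt, false_and, and_self, if_true, if_false, mul_one]
        exact hK x y h (le_mul_of_isConfig hq0 hq1 ht0 hconf hx hy h hyx)
    · simpa [hyx] using hK1
  unfold Vqt
  simp only [← Finset.prod_mul_distrib, Finset.abs_prod]
  calc _ ≤ ∏ x ∈ X, ∏ y ∈ X, K * (if y < x then M x * M y else 1) :=
        Finset.prod_le_prod (fun x _ => Finset.prod_nonneg fun y _ => abs_nonneg _) fun x hx =>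
          Finset.prod_le_prod (fun y _ => abs_nonneg _) fun y hy => hpair x hx y hy
    _ = K ^ (N * N) * ∏ x ∈ X, M x ^ (X.card - 1) := by
        simp only [Finset.prod_mul_distrib, Finset.prod_const, hcard, pow_mul]
        rw [prod_prod_pair, hcard]
    _ = _ := by
        congr 1
        refine Finset.prod_congr rfl fun x _ => ?_
        rw [hcard, Real.rpow_mul (by positivity), ← Real.rpow_natCast, Nat.cast_sub hN,
          Nat.cast_one]

lemma exists_CNconst_bound (q t ζp ζm : ℝ) (N : ℕ) :
    ∃ C, 0 ≤ C ∧ ∀ k ≤ N, |CNconst q t ζp ζm N k| ≤ C :=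
  ⟨∑ k ∈ Finset.range (N + 1), |CNconst q t ζp ζm N k|, by positivity, fun k hk =>
    Finset.single_le_sum (f := fun k => |CNconst q t ζp ζm N k|) (fun _ _ => abs_nonneg _)
      (Finset.mem_range.2 (Nat.lt_succ_of_le hk))⟩

lemma max_rpow_mul_abs_le_envelope {δ x : ℝ} (hδ : 0 < δ) (hx : x ≠ 0) :
    max 1 |x| ^ (-(1 + δ)) * |x| ≤ envelope δ x := by
  have hx0 : 0 < |x| := abs_pos.2 hx
  rcases le_total |x| 1 with h | h
  · rw [max_eq_left h, Real.one_rpow, one_mul, envelope, le_min_iff]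
    exact ⟨le_rfl, h.trans (Real.one_le_rpow_of_pos_of_le_one_of_nonpos hx0 h (by linarith))⟩
  · have e : |x| ^ (-(1 + δ)) * |x| = |x| ^ (-δ) := by
      rw [← Real.rpow_add_one hx0.ne']
      ring_nf
    rw [max_eq_right h, e, envelope, le_min_iff]
    exact ⟨(Real.rpow_le_one_of_one_le_of_nonpos h (by linarith)).trans h, le_rfl⟩

lemma exists_one_particle_bound (hq0 : 0 < q) (hq1 : q < 1) {a b c d : ℂ} (hc : c.im ≠ 0)
    (hd : d.im ≠ 0) {D : ℝ} (h : ‖a‖ * ‖b‖ < q ^ (D + 1) * (‖c‖ * ‖d‖)) :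
    ∃ δ, 0 < δ ∧ ∃ C, 0 ≤ C ∧ ∀ x : ℝ, x ≠ 0 →
      max 1 |x| ^ D * ‖Wc q a b c d x‖ ≤ C * envelope δ x := by
  have hcont : Filter.Tendsto (fun δ : ℝ => q ^ (D + 1 + δ) * (‖c‖ * ‖d‖))
      (nhdsWithin 0 (Set.Ioi 0)) (nhds (q ^ (D + 1) * (‖c‖ * ‖d‖))) := by
    have : Continuous fun δ : ℝ => q ^ (D + 1 + δ) * (‖c‖ * ‖d‖) :=
      ((Real.continuous_const_rpow hq0.ne').comp (by fun_prop)).mul continuous_const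
    simpa using (this.tendsto 0).mono_left nhdsWithin_le_nhds
  obtain ⟨δ, hδ, hδ0⟩ := ((hcont.eventually_const_lt h).and self_mem_nhdsWithin).exists
  obtain ⟨C, hC0, hC⟩ := exists_norm_Wc_bound hq0 hq1 hc hd hδ
  refine ⟨δ, hδ0, C, hC0, fun x hx => ?_⟩
  have hm : 0 < max 1 |x| := by positivity
  calc max 1 |x| ^ D * ‖Wc q a b c d x‖
      = max 1 |x| ^ (-(1 + δ)) * (‖Wc q a b c d x‖ * max 1 |x| ^ (D + 1 + δ)) := by
        rw [show D = -(1 + δ) + (D + 1 + δ) by ring, Real.rpow_add hm]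
        ring_nf
    _ ≤ max 1 |x| ^ (-(1 + δ)) * (C * |x|) :=
        mul_le_mul_of_nonneg_left (hC x) (by positivity)
    _ = C * (max 1 |x| ^ (-(1 + δ)) * |x|) := by ring
    _ ≤ C * envelope δ x := by gcongr; exact max_rpow_mul_abs_le_envelope hδ0 hx

end Assembly

/-- Summability of the unnormalized weights: if `c = conj d ∈ ℂ∖ℝ`, `R = |c|`, and
`|ab| < R² q^{2τ(N-1)+1}`, then `∑_{X∈Ω_N} |M̃_N(X; q,t; a,b,c,d)| < ∞`. -/
theorem stmt8 (q t ζp ζm : ℝ) (hq0 : 0 < q) (hq1 : q < 1) (ht0 : 0 < t) (ht1 : t < 1)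
    (hζp : 0 < ζp) (hζm : ζm < 0) (N : ℕ) (hN : 1 ≤ N)
    (c d : ℂ) (hcd : c = (starRingEnd ℂ) d) (hc : c.im ≠ 0)
    (a b : ℂ)
    (hab : ‖a * b‖ < ‖c‖ ^ 2 * q ^ (2 * Real.logb q t * ((N : ℝ) - 1) + 1)) :
    Summable (fun X : OmegaN q t ζp ζm N => ‖Mtilde q t ζp ζm N a b c d (X : Finset ℝ)‖) := by
  have hd : d.im ≠ 0 := fun h => hc (by simp [hcd, h])
  have hnorm : ‖d‖ = ‖c‖ := by rw [hcd, Complex.norm_conj]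
  obtain ⟨δ, hδ, K, hK0, hK⟩ := exists_one_particle_bound hq0 hq1 (a := a) (b := b) hc hd
    (D := 2 * Real.logb q t * ((N : ℝ) - 1)) (by
      rw [hnorm, ← norm_mul, ← sq, mul_comm (q ^ _)]
      exact hab)
  obtain ⟨C, hC0, hC⟩ := exists_CNconst_bound q t ζp ζm N
  obtain ⟨V, hV0, hV⟩ := exists_Vqt_bound (ζp := ζp) (ζm := ζm) hq0 hq1 ht0 ht1 hN
  set w := (latticeUnion q t ζp ζm N).indicator (envelope δ)
  have hsum : Summable fun X : Finset ℝ => ∏ x ∈ X, w x :=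
    summable_finsetProd_of_summable_nonneg
      (fun x => Set.indicator_nonneg (fun y _ => envelope_nonneg δ y) x)
      (summable_indicator_latticeUnion hq0 hq1 ht0 hζp.ne' hζm.ne hδ N)
  refine Summable.of_nonneg_of_le (fun _ => norm_nonneg _) (fun X => ?_)
    ((hsum.comp_injective Subtype.val_injective).mul_left (C * V * K ^ N))
  obtain ⟨X, hX⟩ := X
  have hx0 : ∀ x ∈ X, x ≠ 0 := fun x hx h => hX.2.2.1 (h ▸ hx)
  have hwx : ∀ x ∈ X, envelope δ x = w x := fun x hx =>
    (Set.indicator_of_mem (hX.1 ▸ mem_latticeUnion_of_isConfig hq0 hX.2 hx) _).symm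
  have hk : (X.filter (fun x => 0 < x)).card ≤ N := (Finset.card_filter_le _ _).trans_eq hX.1
  simp only [Mtilde, norm_mul, Complex.norm_real, Real.norm_eq_abs, norm_prod,
    Function.comp_apply]
  calc _ ≤ C * (V * ∏ x ∈ X, max 1 |x| ^ (2 * Real.logb q t * ((N : ℝ) - 1))) *
        ∏ x ∈ X, ‖Wc q a b c d x‖ := by
        gcongr
        · exact hC _ hk
        · exact hV X hX
    _ = C * V * ∏ x ∈ X, (max 1 |x| ^ (2 * Real.logb q t * ((N : ℝ) - 1)) *
        ‖Wc q a b c d x‖) := by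
        rw [Finset.prod_mul_distrib]
        ring
    _ ≤ C * V * ∏ x ∈ X, (K * w x) := by
        refine mul_le_mul_of_nonneg_left (Finset.prod_le_prod (fun x _ => by positivity)
          fun x hx => ?_) (mul_nonneg hC0 hV0)
        rw [← hwx x hx]
        exact hK x (hx0 x hx)
    _ = _ := by
        rw [Finset.prod_mul_distrib, Finset.prod_const, hX.1]
        ring
end
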